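/- arXiv:1904.09217 — 2 statements merged into one kernel-verified Lean document; each statement's English description precedes it below -/
import Mathlib

section
/- Let G be a group, let N and G₀ be subgroups of G, let N₀ be a subgroup of G contained in both N and G₀, let T be a normal subgroup of N, and set T₀ = T ∩ N₀. Consider the equivalence relation on (N/T) × (G₀/T₀) generated by (nT, gT₀) ∼ (nmT, gmT₀) for m ∈ N₀ (this is well defined since T is normal in N and T₀ ⊆ T ∩ N₀). Then the assignment (nT, gT₀) ↦ (gN₀, g·n⁻¹·T) descends to a well-defined bijection from the quotient of (N/T) × (G₀/T₀) by this equivalence relation onto the set of pairs (g₁N₀, g₂T) ∈ (G₀/N₀) × (G/T) such that g₁N = g₂N. -/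
/-- The coset-level bijection `W ×^{W_a} (G₀/T₀) ≅ (G₀/N₀) ×_{G/N} (G/T)`:
the assignment `(nT, gT₀) ↦ (gN₀, g·n⁻¹·T)` descends to a bijection from the quotient of
`(N/T) × (G₀/T₀)` by the equivalence relation generated by
`(nT, gT₀) ∼ (nmT, gmT₀)` for `m ∈ N₀`, onto the set of pairs
`(g₁N₀, g₂T)` with `g₁N = g₂N`. -/
theorem coset_fiber_product_bijection
    {G : Type*} [Group G] (N G₀ N₀ T : Subgroup G)
    (hN₀N : N₀ ≤ N) (hN₀G₀ : N₀ ≤ G₀)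
    (hTN : T ≤ N)
    (hTnormal : ∀ n ∈ N, ∀ t ∈ T, n * t * n⁻¹ ∈ T) :
    ∃ f : Quot (fun (p q : (N ⧸ T.subgroupOf N) × (G₀ ⧸ (T ⊓ N₀).subgroupOf G₀)) =>
        ∃ (n : N) (g : G₀) (m : N₀),
          p = (QuotientGroup.mk n, QuotientGroup.mk g) ∧
          q = (QuotientGroup.mk (n * ⟨(m : G), hN₀N m.2⟩),
               QuotientGroup.mk (g * ⟨(m : G), hN₀G₀ m.2⟩))) →
        {pq : (G₀ ⧸ N₀.subgroupOf G₀) × (G ⧸ T) //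
          ∃ (g₁ : G₀) (g₂ : G), pq.1 = QuotientGroup.mk g₁ ∧ pq.2 = QuotientGroup.mk g₂ ∧
            (g₁ : G)⁻¹ * g₂ ∈ N},
      Function.Bijective f ∧
      ∀ (n : N) (g : G₀),
        (f (Quot.mk _ (QuotientGroup.mk n, QuotientGroup.mk g))).val =
          (QuotientGroup.mk g, QuotientGroup.mk ((g : G) * (n : G)⁻¹)) := by
  have mk_eq : ∀ (n n' : N) (g g' : G₀), (n : G)⁻¹ * n' ∈ T → (g : G)⁻¹ * g' ∈ T ⊓ N₀ →
      ((g : G) * (n : G)⁻¹)⁻¹ * ((g' : G) * (n' : G)⁻¹) ∈ T := by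
    intro n n' g g' hn hg
    have h := T.mul_mem (hTnormal n n.2 _ hg.1)
      (hTnormal n n.2 _ (T.inv_mem hn))
    convert h using 1
    group
  let φ : (N ⧸ T.subgroupOf N) × (G₀ ⧸ (T ⊓ N₀).subgroupOf G₀) →
      {pq : (G₀ ⧸ N₀.subgroupOf G₀) × (G ⧸ T) //
          ∃ (g₁ : G₀) (g₂ : G), pq.1 = QuotientGroup.mk g₁ ∧ pq.2 = QuotientGroup.mk g₂ ∧
            (g₁ : G)⁻¹ * g₂ ∈ N} := fun p =>
    Quotient.liftOn₂' p.1 p.2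
      (fun n g => ⟨(QuotientGroup.mk g, QuotientGroup.mk ((g : G) * (n : G)⁻¹)),
        g, (g : G) * (n : G)⁻¹, rfl, rfl, by simp⟩)
      (by
        intro n g n' g' hn hg
        rw [QuotientGroup.leftRel_apply, Subgroup.mem_subgroupOf] at hn hg
        refine Subtype.ext (Prod.ext (QuotientGroup.eq.2 ?_) (QuotientGroup.eq.2 ?_))
        · exact Subgroup.mem_subgroupOf.2 hg.2
        · exact mk_eq n n' g g' hn hg)
  refine ⟨Quot.lift φ ?_, ⟨?_, ?_⟩, fun n g => rfl⟩
  · rintro _ _ ⟨n, g, m, rfl, rfl⟩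
    refine Subtype.ext (Prod.ext (QuotientGroup.eq.2 ?_) (QuotientGroup.eq.2 ?_))
    · simp [Subgroup.mem_subgroupOf]
    · simp [mul_assoc]
  · rintro ⟨⟨p, q⟩⟩ ⟨⟨p', q'⟩⟩ h
    induction p using QuotientGroup.induction_on with | H n
    induction q using QuotientGroup.induction_on with | H g
    induction p' using QuotientGroup.induction_on with | H n'
    induction q' using QuotientGroup.induction_on with | H g'
    have h' := congrArg Subtype.val h
    have hm : (g : G)⁻¹ * g' ∈ N₀ :=
      Subgroup.mem_subgroupOf.1 (QuotientGroup.eq.1 (congrArg Prod.fst h'))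
    have ht : ((g : G) * (n : G)⁻¹)⁻¹ * ((g' : G) * (n' : G)⁻¹) ∈ T :=
      QuotientGroup.eq.1 (congrArg Prod.snd h')
    refine Quot.sound ⟨n, g, ⟨_, hm⟩, rfl, Prod.ext (QuotientGroup.eq.2 ?_) ?_⟩
    · rw [Subgroup.mem_subgroupOf]
      have hc := hTnormal _ (N.inv_mem n'.2) _ ht
      convert hc using 1
      simp only [Subgroup.coe_mul, Subgroup.coe_inv]
      group
    · exact congrArg QuotientGroup.mk (Subtype.ext (by simp))
  · rintro ⟨⟨p, q⟩, g₁, g₂, hp, hq, hN⟩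
    dsimp only at hp hq
    subst hp hq
    refine ⟨Quot.mk _ (QuotientGroup.mk ⟨_, N.inv_mem hN⟩, QuotientGroup.mk g₁), ?_⟩
    refine Subtype.ext (Prod.ext rfl (congrArg QuotientGroup.mk ?_))
    simp
end

section
/- Let k be a field, L a Lie algebra over k, and c a k-subspace of L with ⁅Y, Z⁆ = 0 for all Y, Z ∈ c. Let A = k[ε] be the ring of dual numbers (ε² = 0) and consider the base-changed Lie algebra L_A = A ⊗_k L over A. For a k-linear map T : c → L, let c'_T ⊆ L_A denote the A-submodule generated by the set {1 ⊗ a + ε ⊗ T(a) : a ∈ c}. Then: (i) the bracket of L_A vanishes identically on c'_T if and only if ⁅T(y₁), y₂⁆ + ⁅y₁, T(y₂)⁆ = 0 for all y₁, y₂ ∈ c; and (ii) for two such k-linear maps T₁, T₂ : c → L, one has c'_{T₁} = c'_{T₂} if and only if T₁(y) − T₂(y) ∈ c for every y ∈ c. -/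
open scoped TensorProduct

/-- For a `k`-linear map `T : c → L`, the `k[ε]`-submodule `c'_T` of `k[ε] ⊗[k] L`
generated by the elements `1 ⊗ a + ε ⊗ T(a)` for `a ∈ c`. -/
noncomputable def dualNumberDeform {k L : Type*} [Field k] [LieRing L] [LieAlgebra k L]
    (c : Submodule k L) (T : c →ₗ[k] L) :
    Submodule (DualNumber k) (DualNumber k ⊗[k] L) :=
  Submodule.span (DualNumber k)
    {x | ∃ a : c, x = (1 : DualNumber k) ⊗ₜ[k] (a : L) + DualNumber.eps ⊗ₜ[k] T a}

/-- An element `1 ⊗ a + ε ⊗ b` of `k[ε] ⊗[k] L` determines `a` and `b`. -/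
theorem one_tmul_add_eps_tmul_inj {k M : Type*} [Field k] [AddCommGroup M] [Module k M]
    {a b a' b' : M} :
    (1 : DualNumber k) ⊗ₜ[k] a + DualNumber.eps ⊗ₜ[k] b = 1 ⊗ₜ[k] a' + DualNumber.eps ⊗ₜ[k] b' ↔
      a = a' ∧ b = b' := by
  refine ⟨fun h => ⟨?_, ?_⟩, fun ⟨ha, hb⟩ => ha ▸ hb ▸ rfl⟩
  · simpa using congrArg
      ((TensorProduct.lid k M).toLinearMap ∘ₗ
        (TrivSqZeroExt.fstHom k k k).toLinearMap.rTensor M) h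
  · simpa using congrArg
      ((TensorProduct.lid k M).toLinearMap ∘ₗ (TrivSqZeroExt.sndHom k k).rTensor M) h

theorem dualNumber_smul_one_tmul_add_eps_tmul {k M : Type*} [Field k] [AddCommGroup M]
    [Module k M] (d : DualNumber k) (a b : M) :
    d • ((1 : DualNumber k) ⊗ₜ[k] a + DualNumber.eps ⊗ₜ[k] b) =
      1 ⊗ₜ[k] (d.fst • a) + DualNumber.eps ⊗ₜ[k] (d.fst • b + d.snd • a) := by
  have h₁ : d = d.fst • 1 + d.snd • DualNumber.eps := by ext <;> simp
  have h₂ : d * DualNumber.eps = d.fst • DualNumber.eps := by ext <;> simp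
  rw [smul_add, TensorProduct.smul_tmul', TensorProduct.smul_tmul', smul_eq_mul, smul_eq_mul,
    mul_one, h₂]
  conv_lhs => rw [h₁]
  simp only [TensorProduct.add_tmul, TensorProduct.tmul_add, TensorProduct.smul_tmul]
  simp
  abel

theorem lie_one_tmul_add_tmul_of_mul_self_eq_zero {k A L : Type*} [CommRing k] [CommRing A]
    [Algebra k A] [LieRing L] [LieAlgebra k L] {e : A} (he : e * e = 0) (a b a' b' : L) :
    ⁅(1 : A) ⊗ₜ[k] a + e ⊗ₜ[k] b, (1 : A) ⊗ₜ[k] a' + e ⊗ₜ[k] b'⁆ =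
      1 ⊗ₜ[k] ⁅a, a'⁆ + e ⊗ₜ[k] (⁅b, a'⁆ + ⁅a, b'⁆) := by
  simp only [add_lie, lie_add, LieAlgebra.ExtendScalars.bracket_tmul, one_mul, mul_one, he,
    TensorProduct.zero_tmul, add_zero, TensorProduct.tmul_add]
  abel

theorem lie_one_tmul_add_eps_tmul {k L : Type*} [Field k] [LieRing L] [LieAlgebra k L]
    (a b a' b' : L) :
    ⁅(1 : DualNumber k) ⊗ₜ[k] a + DualNumber.eps ⊗ₜ[k] b,
        (1 : DualNumber k) ⊗ₜ[k] a' + DualNumber.eps ⊗ₜ[k] b'⁆ =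
      1 ⊗ₜ[k] ⁅a, a'⁆ + DualNumber.eps ⊗ₜ[k] (⁅b, a'⁆ + ⁅a, b'⁆) :=
  lie_one_tmul_add_tmul_of_mul_self_eq_zero (A := DualNumber k) DualNumber.eps_mul_eps a b a' b'

theorem mem_dualNumberDeform_iff {k L : Type*} [Field k] [LieRing L] [LieAlgebra k L]
    {c : Submodule k L} {T : c →ₗ[k] L} {x : DualNumber k ⊗[k] L} :
    x ∈ dualNumberDeform c T ↔
      ∃ a b : c, x = (1 : DualNumber k) ⊗ₜ[k] (a : L) + DualNumber.eps ⊗ₜ[k] (T a + b) := by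
  constructor
  · intro hx
    induction hx using Submodule.span_induction with
    | mem x hx =>
      obtain ⟨a, rfl⟩ := hx
      exact ⟨a, 0, by simp⟩
    | zero => exact ⟨0, 0, by simp⟩
    | add x y _ _ hx hy =>
      obtain ⟨a, b, rfl⟩ := hx
      obtain ⟨a', b', rfl⟩ := hy
      refine ⟨a + a', b + b', ?_⟩
      simp only [map_add, Submodule.coe_add, TensorProduct.tmul_add]
      abel
    | smul d x _ hx =>
      obtain ⟨a, b, rfl⟩ := hx
      refine ⟨d.fst • a, d.fst • b + d.snd • a, ?_⟩
      rw [dualNumber_smul_one_tmul_add_eps_tmul]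
      simp [add_assoc]
  · rintro ⟨a, b, rfl⟩
    have key : (1 : DualNumber k) ⊗ₜ[k] (a : L) + DualNumber.eps ⊗ₜ[k] (T a + b) =
        ((1 : DualNumber k) ⊗ₜ[k] (a : L) + DualNumber.eps ⊗ₜ[k] T a) +
          (DualNumber.eps : DualNumber k) •
            ((1 : DualNumber k) ⊗ₜ[k] (b : L) + DualNumber.eps ⊗ₜ[k] T b) := by
      rw [dualNumber_smul_one_tmul_add_eps_tmul]
      simp [TensorProduct.tmul_add, add_assoc]
    rw [key]
    exact add_mem (Submodule.subset_span ⟨a, rfl⟩)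
      (Submodule.smul_mem _ _ (Submodule.subset_span ⟨b, rfl⟩))

theorem dualNumberDeform_le_iff {k L : Type*} [Field k] [LieRing L] [LieAlgebra k L]
    {c : Submodule k L} {T₁ T₂ : c →ₗ[k] L} :
    dualNumberDeform c T₁ ≤ dualNumberDeform c T₂ ↔ ∀ y : c, T₁ y - T₂ y ∈ c := by
  constructor
  · intro h y
    obtain ⟨a, b, hab⟩ := mem_dualNumberDeform_iff.1 (h (Submodule.subset_span ⟨y, rfl⟩))
    obtain ⟨hya, hT⟩ := one_tmul_add_eps_tmul_inj.1 hab
    obtain rfl : y = a := Subtype.ext hya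
    simp [hT]
  · refine fun h => Submodule.span_le.2 ?_
    rintro _ ⟨a, rfl⟩
    exact mem_dualNumberDeform_iff.2 ⟨a, ⟨_, h a⟩, by simp⟩

/-- The tangent-space computation for the variety of abelian subalgebras: for an abelian
subspace `c` of a Lie algebra `L` over `k` and `k`-linear `T : c → L`,
(i) the bracket of `k[ε] ⊗[k] L` vanishes identically on `c'_T` iff
`⁅T y₁, y₂⁆ + ⁅y₁, T y₂⁆ = 0` on `c`, and
(ii) for two such maps, `c'_{T₁} = c'_{T₂}` iff `T₁ − T₂` maps `c` into `c`. -/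
theorem tangent_space_of_abelian_subalgebras
    {k L : Type*} [Field k] [LieRing L] [LieAlgebra k L]
    (c : Submodule k L)
    (habel : ∀ Y ∈ c, ∀ Z ∈ c, ⁅Y, Z⁆ = 0) :
    (∀ T : c →ₗ[k] L,
      (∀ x ∈ dualNumberDeform c T, ∀ y ∈ dualNumberDeform c T, ⁅x, y⁆ = 0) ↔
        ∀ y₁ y₂ : c, ⁅T y₁, (y₂ : L)⁆ + ⁅(y₁ : L), T y₂⁆ = 0) ∧
    (∀ T₁ T₂ : c →ₗ[k] L,
      (∀ y₁ y₂ : c, ⁅T₁ y₁, (y₂ : L)⁆ + ⁅(y₁ : L), T₁ y₂⁆ = 0) →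
      (∀ y₁ y₂ : c, ⁅T₂ y₁, (y₂ : L)⁆ + ⁅(y₁ : L), T₂ y₂⁆ = 0) →
      (dualNumberDeform c T₁ = dualNumberDeform c T₂ ↔ ∀ y : c, T₁ y - T₂ y ∈ c)) := by
  refine ⟨fun T => ⟨fun h y₁ y₂ => ?_, fun h x hx y hy => ?_⟩, fun T₁ T₂ _ _ => ?_⟩
  · have h₀ := h _ (Submodule.subset_span ⟨y₁, rfl⟩) _ (Submodule.subset_span ⟨y₂, rfl⟩)
    rw [lie_one_tmul_add_eps_tmul] at h₀
    exact (one_tmul_add_eps_tmul_inj (k := k) (a' := 0) (b' := 0).1 (by simpa using h₀)).2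
  · obtain ⟨a, b, rfl⟩ := mem_dualNumberDeform_iff.1 hx
    obtain ⟨a', b', rfl⟩ := mem_dualNumberDeform_iff.1 hy
    have hc : ∀ u v : c, ⁅(u : L), (v : L)⁆ = 0 := fun u v => habel u u.2 v v.2
    rw [lie_one_tmul_add_eps_tmul, add_lie, lie_add, hc, hc, hc, add_zero, add_zero, h]
    simp
  · rw [le_antisymm_iff, dualNumberDeform_le_iff, dualNumberDeform_le_iff]
    exact and_iff_left_of_imp fun h y => by simpa using neg_mem (h y)
end
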